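/- arXiv:1804.03106 — 2 statements merged into one kernel-verified Lean document; each statement's English description precedes it below -/
import Mathlib

section
/- Suppose ρ_j(0) ≠ 0 for all j ∈ Ω_n* = Ω_n∖{0}. Then the fundamental sk-spline s̃k_n(x) = 1/N + (1/N)Σ_{j∈Ω_n*} ρ_j(x)/ρ_j(0) is an sk-spline on Λ_n: setting c_k = (2/N²) Σ_{j∈Ω_n*} cos(j·x_k)/ρ_j(0) for k ∈ Ω_n, one has s̃k_n(x) = 1/N + Σ_{k∈Ω_n} c_k K(x−x_k) and Σ_{k∈Ω_n} c_k = 0. -/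
open Real Finset MeasureTheory

noncomputable section

/-- The index set `Ω_n = {j ∈ ℤ^d : 0 ≤ j_l ≤ 2 n_l - 1}`. -/
def Omega (d : ℕ) (n : Fin d → ℕ) : Finset (Fin d → ℤ) :=
  Fintype.piFinset fun i => Finset.Icc (0 : ℤ) (2 * (n i : ℤ) - 1)

/-- The knot `x_k = (π k₁ / n₁, …, π k_d / n_d)`. -/
def knot (d : ℕ) (n : Fin d → ℕ) (k : Fin d → ℤ) : Fin d → ℝ :=
  fun i => π * (k i : ℝ) / (n i : ℝ)

/-- The dot product `l · x` for `l ∈ ℤ^d`, `x ∈ ℝ^d`. -/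
def dotI (d : ℕ) (l : Fin d → ℤ) (x : Fin d → ℝ) : ℝ := ∑ i, (l i : ℝ) * x i

/-- `N = 2^d n₁ ⋯ n_d`. -/
def Nn (d : ℕ) (n : Fin d → ℕ) : ℝ := ∏ i : Fin d, (2 * (n i : ℝ))

/-- `Ω_n^* = Ω_n \ {0}`. -/
def OmegaStar (d : ℕ) (n : Fin d → ℕ) : Finset (Fin d → ℤ) :=
  (Omega d n).erase 0

/-- `λ_j(x) = Σ_{k ∈ Ω_n} e^{i j·x_k} K(x - x_k)`. -/
def lam (d : ℕ) (n : Fin d → ℕ) (K : (Fin d → ℝ) → ℝ) (j : Fin d → ℤ)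
    (x : Fin d → ℝ) : ℂ :=
  ∑ k ∈ Omega d n, Complex.exp (Complex.I * (dotI d j (knot d n k) : ℂ)) *
    (K (x - knot d n k) : ℂ)

/-- `ρ_j(x) = (2/N)·Re λ_j(x)`. -/
def rho (d : ℕ) (n : Fin d → ℕ) (K : (Fin d → ℝ) → ℝ) (j : Fin d → ℤ)
    (x : Fin d → ℝ) : ℝ := (2 / Nn d n) * (lam d n K j x).re

/-- `σ_j(x) = (2/N)·Im λ_j(x)`. -/
def sigma' (d : ℕ) (n : Fin d → ℕ) (K : (Fin d → ℝ) → ℝ) (j : Fin d → ℤ)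
    (x : Fin d → ℝ) : ℝ := (2 / Nn d n) * (lam d n K j x).im

/-- The fundamental sk-spline `s̃k_n(x) = 1/N + (1/N) Σ_{j∈Ω_n*} ρ_j(x)/ρ_j(0)`. -/
def fundSk (d : ℕ) (n : Fin d → ℕ) (K : (Fin d → ℝ) → ℝ) (x : Fin d → ℝ) : ℝ :=
  1 / Nn d n + (1 / Nn d n) * ∑ j ∈ OmegaStar d n, rho d n K j x / rho d n K j 0

/-- The interpolating sk-spline `sk_n(f,x) = Σ_{k∈Ω_n} f(x_k) s̃k_n(x - x_k)`. -/
def skInterp (d : ℕ) (n : Fin d → ℕ) (K : (Fin d → ℝ) → ℝ)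
    (f : (Fin d → ℝ) → ℝ) (x : Fin d → ℝ) : ℝ :=
  ∑ k ∈ Omega d n, f (knot d n k) * fundSk d n K (x - knot d n k)

/-- A vanishing exponential sum: `exp (i π j / n)` is a `2n`-th root of unity different from `1`
when `0 < j < 2n`. -/
theorem sum_Icc_exp_eq_zero (n : ℕ) (j : ℤ) (hj : 0 < j) (hjn : j < 2 * n) :
    ∑ k ∈ Finset.Icc (0 : ℤ) (2 * (n : ℤ) - 1),
      Complex.exp (Complex.I * ((j : ℝ) * (π * (k : ℝ) / (n : ℝ)) : ℝ)) = 0 := by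
  have hn : (n : ℂ) ≠ 0 := by
    have : n ≠ 0 := by rintro rfl; simp at hjn; omega
    exact_mod_cast this
  set z : ℂ := Complex.exp (Complex.I * (j * (π / n))) with hz
  have hreindex : ∑ k ∈ Finset.Icc (0 : ℤ) (2 * (n : ℤ) - 1),
      Complex.exp (Complex.I * ((j : ℝ) * (π * (k : ℝ) / (n : ℝ)) : ℝ)) =
      ∑ m ∈ Finset.range (2 * n), z ^ m := by
    refine Finset.sum_nbij' Int.toNat (fun m => (m : ℤ)) ?_ ?_ ?_ ?_ ?_
    · intro k hk
      simp only [Finset.mem_Icc, Finset.mem_range] at *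
      omega
    · intro k hk
      simp only [Finset.mem_Icc, Finset.mem_range] at *
      omega
    · intro k hk
      simp only [Finset.mem_Icc] at hk
      omega
    · intro k _
      simp
    · intro k hk
      simp only [Finset.mem_Icc] at hk
      lift k to ℕ using hk.1
      rw [hz, ← Complex.exp_nat_mul, Int.toNat_natCast]
      congr 1
      push_cast
      ring
  have hpow : z ^ (2 * n) = 1 := by
    rw [hz, ← Complex.exp_nat_mul, Complex.exp_eq_one_iff]
    refine ⟨j, ?_⟩
    push_cast
    field_simp
  have hne : z ≠ 1 := by
    rw [hz, Ne, Complex.exp_eq_one_iff]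
    rintro ⟨m, hm⟩
    have hpi : (π : ℂ) ≠ 0 := Complex.ofReal_ne_zero.2 Real.pi_ne_zero
    have hjm : (j : ℂ) = m * 2 * n := by
      field_simp at hm
      apply mul_left_cancel₀ (mul_ne_zero Complex.I_ne_zero hpi)
      linear_combination (Complex.I * π) * hm
    have hjm' : j = m * 2 * n := by exact_mod_cast hjm
    have hdvd : (2 * n : ℤ) ∣ j := ⟨m, by rw [hjm']; ring⟩
    exact absurd (Int.le_of_dvd hj hdvd) (by omega)
  rw [hreindex]
  have := mul_geom_sum z (2 * n)
  rw [hpow, sub_self] at this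
  exact (mul_eq_zero.1 this).resolve_left (sub_ne_zero.2 hne)

theorem sum_Omega_exp_eq_zero (d : ℕ) (n : Fin d → ℕ) (j : Fin d → ℤ) (hj : j ∈ OmegaStar d n) :
    ∑ k ∈ Omega d n, Complex.exp (Complex.I * (dotI d j (knot d n k) : ℂ)) = 0 := by
  obtain ⟨hj0, hj⟩ := Finset.mem_erase.1 hj
  obtain ⟨i, hi⟩ := Function.ne_iff.1 hj0
  have hji := Finset.mem_Icc.1 (Fintype.mem_piFinset.1 hj i)
  have hprod : ∑ k ∈ Omega d n, Complex.exp (Complex.I * (dotI d j (knot d n k) : ℂ)) =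
      ∏ l, ∑ k ∈ Finset.Icc (0 : ℤ) (2 * (n l : ℤ) - 1),
        Complex.exp (Complex.I * ((j l : ℝ) * (π * (k : ℝ) / (n l : ℝ)) : ℝ)) := by
    rw [Finset.prod_univ_sum]
    refine Finset.sum_congr rfl fun k _ => ?_
    rw [← Complex.exp_sum, ← Finset.mul_sum, ← Complex.ofReal_sum]
    rfl
  rw [hprod]
  refine Finset.prod_eq_zero (Finset.mem_univ i) (sum_Icc_exp_eq_zero (n i) (j i) ?_ (by omega))
  exact lt_of_le_of_ne hji.1 (Ne.symm hi)

theorem sum_Omega_cos_eq_zero (d : ℕ) (n : Fin d → ℕ) (j : Fin d → ℤ) (hj : j ∈ OmegaStar d n) :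
    ∑ k ∈ Omega d n, Real.cos (dotI d j (knot d n k)) = 0 := by
  have h := congrArg Complex.re (sum_Omega_exp_eq_zero d n j hj)
  simpa [Complex.re_sum, mul_comm Complex.I, Complex.exp_ofReal_mul_I_re] using h

theorem rho_eq_sum_cos (d : ℕ) (n : Fin d → ℕ) (K : (Fin d → ℝ) → ℝ) (j : Fin d → ℤ)
    (x : Fin d → ℝ) :
    rho d n K j x = (2 / Nn d n) *
      ∑ k ∈ Omega d n, Real.cos (dotI d j (knot d n k)) * K (x - knot d n k) := by
  simp only [rho, lam, Complex.re_sum, Complex.re_mul_ofReal, mul_comm Complex.I,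
    Complex.exp_ofReal_mul_I_re]

/-- Lemma 5: the fundamental sk-spline is an sk-spline: it can be written as
`1/N + Σ_{k∈Ω_n} c_k K(x - x_k)` with `Σ c_k = 0`, where
`c_k = (2/N²) Σ_{j∈Ω_n*} cos(j·x_k)/ρ_j(0)`. -/
theorem statement5 (d : ℕ) (hd : 1 ≤ d) (n : Fin d → ℕ) (hn : ∀ i, 1 ≤ n i)
    (K : (Fin d → ℝ) → ℝ) (hK : Continuous K)
    (hKper : ∀ (x : Fin d → ℝ) (m : Fin d → ℤ),
      K (x + fun i => 2 * π * (m i : ℝ)) = K x)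
    (hrho : ∀ j ∈ OmegaStar d n, rho d n K j 0 ≠ 0) :
    (∀ x : Fin d → ℝ,
      fundSk d n K x = 1 / Nn d n +
        ∑ k ∈ Omega d n,
          ((2 / (Nn d n) ^ 2) *
            ∑ j ∈ OmegaStar d n, Real.cos (dotI d j (knot d n k)) / rho d n K j 0) *
          K (x - knot d n k)) ∧
    (∑ k ∈ Omega d n,
      (2 / (Nn d n) ^ 2) *
        ∑ j ∈ OmegaStar d n, Real.cos (dotI d j (knot d n k)) / rho d n K j 0) = 0 := by
  constructor
  · intro x
    simp only [fundSk, rho_eq_sum_cos d n K _ x]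
    congr 1
    simp only [Finset.mul_sum, Finset.sum_mul, Finset.sum_div]
    rw [Finset.sum_comm]
    refine Finset.sum_congr rfl fun k _ => Finset.sum_congr rfl fun j _ => ?_
    ring
  · rw [← Finset.mul_sum, Finset.sum_comm]
    refine mul_eq_zero_of_right _ (Finset.sum_eq_zero fun j hj => ?_)
    rw [← Finset.sum_div, sum_Omega_cos_eq_zero d n j hj, zero_div]

end
end

section
/- Let (a_l)_{l∈ℤ^d} be real with a_l = a_{−l}, Σ|a_l| < ∞, and K(x) = Σ_{l∈ℤ^d} a_l e^{i l·x}. Then for all j, l ∈ ℤ^d, ρ_j(x_l) = cos(j·x_l)·ρ_j(0). -/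
open Real Finset MeasureTheory

noncomputable section

/-- The (complex-valued) kernel `K(x) = Σ_{l ∈ ℤ^d} a_l e^{i l·x}`. -/
def Kc (d : ℕ) (a : (Fin d → ℤ) → ℝ) (x : Fin d → ℝ) : ℂ :=
  ∑' l : Fin d → ℤ, (a l : ℂ) * Complex.exp (Complex.I * (dotI d l x : ℂ))

/-- The real part of the kernel; for `a_l = a_{-l}` this is the kernel itself. -/
def Kr (d : ℕ) (a : (Fin d → ℤ) → ℝ) (x : Fin d → ℝ) : ℝ := (Kc d a x).re

theorem sum_Omega_reflect {M : Type*} [AddCommMonoid M] {d : ℕ} {n : Fin d → ℕ}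
    (hn : ∀ i, 1 ≤ n i) {F : (Fin d → ℤ) → M}
    (hF : ∀ k m : Fin d → ℤ, F (fun i => k i + 2 * (n i : ℤ) * m i) = F k)
    (l : Fin d → ℤ) :
    ∑ k ∈ Omega d n, F (fun i => l i - k i) = ∑ k ∈ Omega d n, F k := by
  have hpos : ∀ i, (0 : ℤ) < 2 * (n i : ℤ) := fun i => by have := hn i; omega
  have hmem : ∀ k : Fin d → ℤ, (fun i => (l i - k i) % (2 * (n i : ℤ))) ∈ Omega d n := by
    intro k
    simp only [Omega, Fintype.mem_piFinset, Finset.mem_Icc]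
    intro i
    have h₁ := Int.emod_nonneg (l i - k i) (hpos i).ne'
    have h₂ := Int.emod_lt_of_pos (l i - k i) (hpos i)
    exact ⟨h₁, by omega⟩
  have hinv : ∀ k ∈ Omega d n,
      (fun i => (l i - (l i - k i) % (2 * (n i : ℤ))) % (2 * (n i : ℤ))) = k := by
    intro k hk
    simp only [Omega, Fintype.mem_piFinset, Finset.mem_Icc] at hk
    funext i
    rw [Int.sub_emod_emod, sub_sub_cancel]
    exact Int.emod_eq_of_lt (hk i).1 (by have := (hk i).2; omega)
  refine Finset.sum_nbij' (fun k i => (l i - k i) % (2 * (n i : ℤ)))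
    (fun k i => (l i - k i) % (2 * (n i : ℤ))) (fun k _ => hmem k) (fun k _ => hmem k)
    hinv hinv ?_
  intro k _
  rw [← hF (fun i => (l i - k i) % (2 * (n i : ℤ))) (fun i => (l i - k i) / (2 * (n i : ℤ)))]
  congr 1
  funext i
  exact (Int.emod_add_mul_ediv _ _).symm

theorem dotI_add (d : ℕ) (l : Fin d → ℤ) (x y : Fin d → ℝ) :
    dotI d l (x + y) = dotI d l x + dotI d l y := by
  simp [dotI, mul_add, Finset.sum_add_distrib]

theorem dotI_neg (d : ℕ) (l : Fin d → ℤ) (x : Fin d → ℝ) :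
    dotI d l (-x) = -dotI d l x := by
  simp [dotI]

theorem neg_dotI (d : ℕ) (l : Fin d → ℤ) (x : Fin d → ℝ) :
    dotI d (-l) x = -dotI d l x := by
  simp [dotI]

theorem knot_sub (d : ℕ) (n : Fin d → ℕ) (k l : Fin d → ℤ) :
    knot d n (fun i => k i - l i) = knot d n k - knot d n l := by
  funext i
  simp only [knot, Pi.sub_apply]
  push_cast
  ring

theorem knot_add_period {d : ℕ} {n : Fin d → ℕ} (hn : ∀ i, 1 ≤ n i) (k m : Fin d → ℤ) :
    knot d n (fun i => k i + 2 * (n i : ℤ) * m i) =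
      knot d n k + fun i => 2 * π * (m i : ℝ) := by
  funext i
  have : (n i : ℝ) ≠ 0 := by have := hn i; positivity
  simp only [knot, Pi.add_apply]
  push_cast
  field_simp

theorem exp_dotI_add_period (d : ℕ) (l m : Fin d → ℤ) (x : Fin d → ℝ) :
    Complex.exp (Complex.I * (dotI d l (x + fun i => 2 * π * (m i : ℝ)) : ℂ)) =
      Complex.exp (Complex.I * (dotI d l x : ℂ)) := by
  refine Complex.exp_eq_exp_iff_exists_int.2 ⟨∑ i, l i * m i, ?_⟩
  have h : dotI d l (fun i => 2 * π * (m i : ℝ)) = 2 * π * ((∑ i, l i * m i : ℤ) : ℝ) := by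
    push_cast
    rw [dotI, Finset.mul_sum]
    exact Finset.sum_congr rfl fun i _ => by ring
  rw [dotI_add, h]
  push_cast
  ring

theorem Kr_add_period (d : ℕ) (a : (Fin d → ℤ) → ℝ) (m : Fin d → ℤ) (x : Fin d → ℝ) :
    Kr d a (x + fun i => 2 * π * (m i : ℝ)) = Kr d a x := by
  simp only [Kr, Kc, exp_dotI_add_period]

theorem Kr_neg {d : ℕ} {a : (Fin d → ℤ) → ℝ} (ha : ∀ l, a (-l) = a l) (x : Fin d → ℝ) :
    Kr d a (-x) = Kr d a x := by
  simp only [Kr, Kc]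
  rw [← (Equiv.neg (Fin d → ℤ)).tsum_eq]
  simp only [Equiv.neg_apply, ha, neg_dotI, dotI_neg, neg_neg]

/-- For an even kernel, discrete convolution with a character has that character as
eigenvector; the eigenvalue is the (conjugate) discrete Fourier coefficient. -/
theorem lam_Kr_knot {d : ℕ} {n : Fin d → ℕ} (hn : ∀ i, 1 ≤ n i)
    (a : (Fin d → ℤ) → ℝ) (ha : ∀ l, a (-l) = a l) (j l : Fin d → ℤ) :
    lam d n (Kr d a) j (knot d n l) =
      Complex.exp (Complex.I * (dotI d j (knot d n l) : ℂ)) *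
        (starRingEnd ℂ) (lam d n (Kr d a) j 0) := by
  rw [lam, ← sum_Omega_reflect hn ?_ l, lam, map_sum, Finset.mul_sum]
  · refine Finset.sum_congr rfl fun k _ => ?_
    rw [knot_sub, sub_sub_cancel, zero_sub, Kr_neg ha, sub_eq_add_neg, dotI_add, dotI_neg,
      map_mul, Complex.conj_ofReal, ← Complex.exp_conj, map_mul, Complex.conj_I,
      Complex.conj_ofReal, ← mul_assoc, ← Complex.exp_add]
    congr 2
    push_cast
    ring
  · intro k m
    have h : knot d n l - (knot d n k + fun i => 2 * π * (m i : ℝ)) =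
        (knot d n l - knot d n k) + fun i => 2 * π * ((-m) i : ℝ) := by
      funext i
      simp only [Pi.sub_apply, Pi.add_apply, Pi.neg_apply]
      push_cast
      ring
    rw [knot_add_period hn, exp_dotI_add_period, h, Kr_add_period]

/-- `ρ_j(x_l) = cos(j·x_l)·ρ_j(0)` for all `j, l ∈ ℤ^d`. -/
theorem statement7 (d : ℕ) (hd : 1 ≤ d) (n : Fin d → ℕ) (hn : ∀ i, 1 ≤ n i)
    (a : (Fin d → ℤ) → ℝ) (ha : ∀ l, a (-l) = a l)
    (hsum : Summable fun l : Fin d → ℤ => |a l|)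
    (j l : Fin d → ℤ) :
    rho d n (Kr d a) j (knot d n l) =
      Real.cos (dotI d j (knot d n l)) * rho d n (Kr d a) j 0 := by
  have h0 := lam_Kr_knot hn a ha j 0
  have hk : knot d n 0 = 0 := by
    funext i
    simp [knot]
  have hreal : (lam d n (Kr d a) j 0).im = 0 := by
    rw [hk] at h0
    have := congrArg Complex.im h0
    simp only [dotI, Pi.zero_apply, mul_zero, Finset.sum_const_zero, Complex.ofReal_zero,
      Complex.exp_zero, one_mul, Complex.conj_im] at this
    linarith
  rw [rho, rho, lam_Kr_knot hn a ha, Complex.mul_re, Complex.conj_im, hreal, Complex.conj_re,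
    mul_comm Complex.I, Complex.exp_ofReal_mul_I_re]
  ring

end
end
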